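/- arXiv:2012.10846 — 3 statements merged into one kernel-verified Lean document; each statement's English description precedes it below -/
import Mathlib

section
/- For every n ≥ 1 and every reflexive binary relation canRead on Fin n, f_opt ≤ f_maj. -/
/-- `P` reads-from `Q`: some process in `P` can read what some process in `Q` writes. -/
def readsFrom {n : ℕ} (canRead : Fin n → Fin n → Prop) (P Q : Finset (Fin n)) : Prop :=
  ∃ p ∈ P, ∃ q ∈ Q, canRead p q

/-- `P ↔ Q`: the two sets of processes can communicate through shared memory. -/
def bothRead {n : ℕ} (canRead : Fin n → Fin n → Prop) (P Q : Finset (Fin n)) : Prop :=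
  readsFrom canRead P Q ∧ readsFrom canRead Q P

/-- `f_opt`: the largest integer `f` such that `P ↔ Q` for every pair of sets of
processes `P` and `Q`, each of cardinality `n - f`. -/
noncomputable def fopt (n : ℕ) (canRead : Fin n → Fin n → Prop) : ℕ :=
  sSup {f : ℕ | ∀ P Q : Finset (Fin n),
    P.card = n - f → Q.card = n - f → bothRead canRead P Q}

/-- `C(P)`: the set of processes some process in `P` can read what they write. -/
def commSet {n : ℕ} (canRead : Fin n → Fin n → Prop) (P : Finset (Fin n)) : Set (Fin n) :=
  {q | ∃ p ∈ P, canRead p q}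

/-- `f_maj`: the largest integer `f` such that every set `P` of `n - f` processes
can communicate with a majority of the processes. -/
noncomputable def fmaj (n : ℕ) (canRead : Fin n → Fin n → Prop) : ℕ :=
  sSup {f : ℕ | ∀ P : Finset (Fin n), P.card = n - f → (commSet canRead P).ncard > n / 2}

theorem fopt_le_fmaj (n : ℕ) (hn : 1 ≤ n) (canRead : Fin n → Fin n → Prop)
    (hrefl : ∀ p, canRead p p) :
    fopt n canRead ≤ fmaj n canRead := by
  classical
  unfold fopt fmaj
  apply csSup_le'
  intro f hf
  apply le_csSup
  · refine ⟨n, fun g hg => ?_⟩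
    by_contra hlt
    have h := hg ∅ (by simp; omega)
    simp [commSet] at h
  · intro P hP
    let C : Finset (Fin n) := Finset.univ.filter (fun q => ∃ p ∈ P, canRead p q)
    have hC : commSet canRead P = (C : Set (Fin n)) := by
      ext q
      simp [commSet, C]
    rw [hC, Set.ncard_coe_finset]
    have hsub : P ⊆ C := by
      intro p hp
      simp only [C, Finset.mem_filter, Finset.mem_univ, true_and]
      exact ⟨p, hp, hrefl p⟩
    have h1 := Finset.card_le_card hsub
    have h2 : f < C.card := by
      by_contra hle
      have hcc : Cᶜ.card = n - C.card := by
        rw [Finset.card_compl, Fintype.card_fin]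
      obtain ⟨Q, hQ, hQc⟩ := Finset.exists_subset_card_eq
        (show n - f ≤ Cᶜ.card by omega)
      obtain ⟨⟨p, hp, q, hq, hr⟩, _⟩ := hf P Q hP hQc
      have hq' := hQ hq
      rw [Finset.mem_compl] at hq'
      apply hq'
      simp only [C, Finset.mem_filter, Finset.mem_univ, true_and]
      exact ⟨p, hp, hr⟩
    omega
end

section
/- In the cluster-based model on n ≥ 1 processes, f_opt = f_maj. -/
theorem cluster_fopt_eq_fmaj (n m : ℕ) (hn : 1 ≤ n) (cl : Fin n → Fin m)
    (hcl : Function.Surjective cl) :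
    fopt n (fun p q => cl p = cl q) = fmaj n (fun p q => cl p = cl q) := by
  unfold fopt fmaj
  congr 1
  ext f
  simp only [Set.mem_setOf_eq]
  constructor
  · intro h P hP
    by_contra hlt
    have hsub : (P : Set (Fin n)) ⊆ commSet (fun p q => cl p = cl q) P :=
      fun p hp => ⟨p, hp, rfl⟩
    have h1 := Set.ncard_le_ncard hsub (Set.toFinite _)
    rw [Set.ncard_coe_finset] at h1
    have h2 := Set.ncard_add_ncard_compl (commSet (fun p q => cl p = cl q) P)
    rw [Nat.card_eq_fintype_card, Fintype.card_fin] at h2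
    have h3 : n - f ≤ ((commSet (fun p q => cl p = cl q) P)ᶜ).ncard := by omega
    obtain ⟨Q, hQ, hQc⟩ := Set.exists_subset_card_eq h3
    have hfin : Q.Finite := Set.toFinite Q
    obtain ⟨⟨p, hp, q, hq, hpq⟩, -⟩ := h P hfin.toFinset hP
      (by rw [← Set.ncard_eq_toFinset_card Q hfin, hQc])
    exact hQ (hfin.mem_toFinset.1 hq) ⟨p, hp, hpq⟩
  · intro h P Q hP hQ
    have h1 := h P hP
    have h2 := h Q hQ
    have key : ∃ x, x ∈ commSet (fun p q => cl p = cl q) P ∧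
        x ∈ commSet (fun p q => cl p = cl q) Q := by
      by_contra hne
      have hd : Disjoint (commSet (fun p q => cl p = cl q) P)
          (commSet (fun p q => cl p = cl q) Q) :=
        Set.disjoint_left.2 fun x hx hy => hne ⟨x, hx, hy⟩
      have h3 := Set.ncard_union_eq hd (Set.toFinite _) (Set.toFinite _)
      have h4 := Set.ncard_le_card (commSet (fun p q => cl p = cl q) P ∪
        commSet (fun p q => cl p = cl q) Q)
      rw [Nat.card_eq_fintype_card, Fintype.card_fin] at h4
      omega
    obtain ⟨x, ⟨p, hp, hpx⟩, ⟨q, hq, hqx⟩⟩ := key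
    exact ⟨⟨p, hp, q, hq, hpx.trans hqx.symm⟩, ⟨q, hq, p, hp, hqx.trans hpx.symm⟩⟩
end

section
/- In the cluster-based model on n ≥ 1 processes, for every f ≤ f_opt and all sets of processes P and Q with |C(P)| ≥ n − f and |C(Q)| ≥ n − f, we have P ↔ Q; that is, there exist p' ∈ P and q' ∈ Q belonging to the same cluster. -/
theorem cluster_represent_comm (n m : ℕ) (hn : 1 ≤ n) (cl : Fin n → Fin m)
    (hcl : Function.Surjective cl)
    (f : ℕ) (hf : f ≤ fopt n (fun p q => cl p = cl q))
    (P Q : Finset (Fin n))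
    (hP : n - f ≤ (commSet (fun p q => cl p = cl q) P).ncard)
    (hQ : n - f ≤ (commSet (fun p q => cl p = cl q) Q).ncard) :
    bothRead (fun p q => cl p = cl q) P Q ∧ ∃ p ∈ P, ∃ q ∈ Q, cl p = cl q := by
  have hmem : fopt n (fun p q => cl p = cl q) ∈ {f : ℕ | ∀ P Q : Finset (Fin n),
      P.card = n - f → Q.card = n - f → bothRead (fun p q => cl p = cl q) P Q} := by
    apply Nat.sSup_mem
    · refine ⟨0, fun A B hA hB => ?_⟩
      have hA' : A = Finset.univ := by
        rw [← Finset.card_eq_iff_eq_univ]; simpa using hA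
      have hB' : B = Finset.univ := by
        rw [← Finset.card_eq_iff_eq_univ]; simpa using hB
      subst hA' hB'
      exact ⟨⟨⟨0, hn⟩, Finset.mem_univ _, ⟨0, hn⟩, Finset.mem_univ _, rfl⟩,
        ⟨⟨0, hn⟩, Finset.mem_univ _, ⟨0, hn⟩, Finset.mem_univ _, rfl⟩⟩
    · refine ⟨n, fun g hg => ?_⟩
      by_contra hlt
      have h0 : (∅ : Finset (Fin n)).card = n - g := by
        rw [Finset.card_empty]; omega
      obtain ⟨⟨p, hp, _⟩, _⟩ := hg ∅ ∅ h0 h0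
      simp at hp
  have key : ∃ p ∈ P, ∃ q ∈ Q, cl p = cl q := by
    classical
    rw [Set.ncard_eq_toFinset_card'] at hP hQ
    obtain ⟨A, hA, hAc⟩ := Finset.exists_subset_card_eq
      (le_trans (Nat.sub_le_sub_left hf n) hP)
    obtain ⟨B, hB, hBc⟩ := Finset.exists_subset_card_eq
      (le_trans (Nat.sub_le_sub_left hf n) hQ)
    obtain ⟨⟨a, ha, b, hb, hab⟩, _⟩ := hmem A B hAc hBc
    obtain ⟨p, hp, hpa⟩ := Set.mem_toFinset.mp (hA ha)
    obtain ⟨q, hq, hqb⟩ := Set.mem_toFinset.mp (hB hb)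
    exact ⟨p, hp, q, hq, hpa.trans (hab.trans hqb.symm)⟩
  obtain ⟨p, hp, q, hq, h⟩ := key
  exact ⟨⟨⟨p, hp, q, hq, h⟩, ⟨q, hq, p, hp, h.symm⟩⟩, p, hp, q, hq, h⟩
end
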